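/- Suppose k is an algebraically closed field of characteristic 0 and let P be a set of equivariant permutations. Say F' is monoidally equivalent to F if there exist ρ ∈ P and a gauge transformation g with F' = g·(ρ·F). Then F' is monoidally equivalent to F if and only if there exists ρ = (ρ_Φ, ρ_Γ) ∈ P such that ρ_Φ({φ : F(φ) = 0}) = {φ : F'(φ) = 0} and F(m) = F'(ρ·m) for every invariant monomial m whose support is contained in {φ : F(φ) ≠ 0}. -/

import Mathlib

open Finsupp

/-- The unique additive homomorphism `(Φ →₀ ℤ) →+ (Γ →₀ ℤ)` sending `single φ 1` to `t φ`. -/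
noncomputable def tA {Φ Γ : Type*} (t : Φ → (Γ →₀ ℤ)) : (Φ →₀ ℤ) →+ (Γ →₀ ℤ) :=
  Finsupp.liftAddHom fun φ => zmultiplesHom _ (t φ)

theorem tA_single {Φ Γ : Type*} (t : Φ → (Γ →₀ ℤ)) (φ : Φ) :
    tA t (Finsupp.single φ 1) = t φ := by
  simp [tA]

/-- The action of a gauge transformation `g : Γ → kˣ` on `F : Φ → k`. -/
noncomputable def gaugeAct {k : Type*} [Field k] {Φ Γ : Type*} [Fintype Γ]
    (t : Φ → (Γ →₀ ℤ)) (g : Γ → kˣ) (F : Φ → k) : Φ → k :=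
  fun φ => ((∏ γ : Γ, g γ ^ (t φ) γ : kˣ) : k) * F φ

/-- Gauge equivalence of `F, F' : Φ → k`. -/
def gaugeEquiv {k : Type*} [Field k] {Φ Γ : Type*} [Fintype Γ]
    (t : Φ → (Γ →₀ ℤ)) (F F' : Φ → k) : Prop :=
  ∃ g : Γ → kˣ, F' = gaugeAct t g F

/-- Evaluation of a monomial `m : Φ →₀ ℤ` at a point `F : Φ → k`. -/
noncomputable def evalMon {k : Type*} [Field k] {Φ : Type*} [Fintype Φ] (F : Φ → k) (m : Φ →₀ ℤ) : k :=
  ∏ φ : Φ, F φ ^ m φ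

/-- The action of a permutation of `Φ` on `F : Φ → k`. -/
def permAct {k Φ : Type*} (ρ : Equiv.Perm Φ) (F : Φ → k) : Φ → k :=
  fun φ => F (ρ.symm φ)

/-- A linear map into a module satisfying Baer's criterion factors through any linear map with
smaller kernel. -/
theorem Module.Baer.exists_comp_eq_of_ker_le {R M N Q : Type*} [Ring R] [AddCommGroup M]
    [AddCommGroup N] [AddCommGroup Q] [Module R M] [Module R N] [Module R Q]
    (hQ : Module.Baer R Q) (f : M →ₗ[R] N) (g : M →ₗ[R] Q)
    (hfg : LinearMap.ker f ≤ LinearMap.ker g) : ∃ h : N →ₗ[R] Q, h ∘ₗ f = g := by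
  obtain ⟨h, hh⟩ := hQ.extension_property ((LinearMap.ker f).liftQ f le_rfl)
    (LinearMap.ker_eq_bot.1 (Submodule.ker_liftQ_eq_bot _ _ _ le_rfl))
    ((LinearMap.ker f).liftQ g hfg)
  refine ⟨h, LinearMap.ext fun x => ?_⟩
  simpa using LinearMap.congr_fun hh (Submodule.Quotient.mk x)

/-- The unit group of an algebraically closed field is divisible. -/
theorem IsAlgClosed.units_zpow_surjective {k : Type*} [Field k] [IsAlgClosed k] {n : ℤ}
    (hn : n ≠ 0) : Function.Surjective fun u : kˣ => u ^ n := by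
  have key : ∀ m : ℕ, 0 < m → ∀ u : kˣ, ∃ v : kˣ, v ^ m = u := fun m hm u => by
    obtain ⟨z, hz⟩ := IsAlgClosed.exists_pow_nat_eq (u : k) hm
    have hz0 : z ≠ 0 := by
      rintro rfl
      rw [zero_pow hm.ne'] at hz
      exact u.ne_zero hz.symm
    exact ⟨Units.mk0 z hz0, Units.ext (by simpa using hz)⟩
  intro u
  obtain ⟨m, rfl | rfl⟩ := n.eq_nat_or_neg
  · obtain ⟨v, hv⟩ := key m (by omega) u
    exact ⟨v, by simpa using hv⟩
  · obtain ⟨v, hv⟩ := key m (by omega) u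
    exact ⟨v⁻¹, by simpa using hv⟩

theorem IsAlgClosed.baer_additive_units (k : Type*) [Field k] [IsAlgClosed k] :
    Module.Baer ℤ (Additive kˣ) :=
  letI : DivisibleBy (Additive kˣ) ℤ :=
    divisibleByOfSMulRightSurj _ _ fun hn => IsAlgClosed.units_zpow_surjective hn
  Module.Baer.of_divisible _

theorem tA_apply {Φ Γ : Type*} [Fintype Φ] (t : Φ → (Γ →₀ ℤ)) (m : Φ →₀ ℤ) :
    tA t m = ∑ φ, m φ • t φ := by
  simp only [tA, Finsupp.liftAddHom_apply]
  exact Finsupp.sum_fintype _ _ fun _ => zero_smul _ _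

theorem tA_equivMapDomain {Φ Γ : Type*} [Fintype Φ] (t : Φ → (Γ →₀ ℤ)) (e : Equiv.Perm Φ)
    (e' : Equiv.Perm Γ) (h : ∀ φ, t (e φ) = Finsupp.equivMapDomain e' (t φ)) (m : Φ →₀ ℤ) :
    tA t (Finsupp.equivMapDomain e m) = Finsupp.equivMapDomain e' (tA t m) := by
  rw [tA_apply, tA_apply, ← Equiv.sum_comp e]
  ext γ
  simp [Finsupp.equivMapDomain_apply, h, Finsupp.finsetSum_apply]

theorem evalMon_permAct_equivMapDomain {k Φ : Type*} [Field k] [Fintype Φ] (e : Equiv.Perm Φ)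
    (F : Φ → k) (m : Φ →₀ ℤ) :
    evalMon (permAct e F) (Finsupp.equivMapDomain e m) = evalMon F m := by
  rw [evalMon, evalMon, ← Equiv.prod_comp e]
  simp [permAct, Finsupp.equivMapDomain_apply]

theorem evalMon_gaugeAct {k Φ Γ : Type*} [Field k] [Fintype Φ] [Fintype Γ]
    (t : Φ → (Γ →₀ ℤ)) (g : Γ → kˣ) (F : Φ → k) (m : Φ →₀ ℤ) :
    evalMon (gaugeAct t g F) m = ((∏ γ, g γ ^ (tA t m) γ : kˣ) : k) * evalMon F m := by
  simp only [evalMon, gaugeAct, mul_zpow, Finset.prod_mul_distrib]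
  congr 1
  simp only [← Units.val_zpow_eq_zpow_val, ← Units.coe_prod]
  congr 1
  simp only [← Finset.prod_zpow, ← zpow_mul, tA_apply, Finsupp.finsetSum_apply,
    Finsupp.smul_apply, smul_eq_mul]
  rw [Finset.prod_comm]
  refine Finset.prod_congr rfl fun γ _ => ?_
  simp only [mul_comm (m _)]
  exact (map_sum (zmultiplesHom (Additive kˣ) (Additive.ofMul (g γ))) _ _).symm

theorem gaugeAct_eq_zero_iff {k Φ Γ : Type*} [Field k] [Fintype Γ]
    (t : Φ → (Γ →₀ ℤ)) (g : Γ → kˣ) (F : Φ → k) (φ : Φ) :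
    gaugeAct t g F φ = 0 ↔ F φ = 0 := by
  simp only [gaugeAct, Units.mul_right_eq_zero]

/-- A family of units satisfying every multiplicative relation among the characters `t i` is
the family of values of these characters at a point of the torus. -/
theorem exists_torus_point {k ι Γ : Type*} [Field k] [IsAlgClosed k] [Fintype ι] [Fintype Γ]
    (t : ι → (Γ →₀ ℤ)) (c : ι → kˣ)
    (h : ∀ m : ι →₀ ℤ, tA t m = 0 → ∏ i, c i ^ m i = 1) :
    ∃ g : Γ → kˣ, ∀ i, ∏ γ, g γ ^ (t i) γ = c i := by
  classical
  obtain ⟨f, hf⟩ := (IsAlgClosed.baer_additive_units k).exists_comp_eq_of_ker_le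
    (tA t).toIntLinearMap
    (Finsupp.linearCombination ℤ fun i => Additive.ofMul (c i)) fun m hm => by
      have := h m hm
      rw [LinearMap.mem_ker, Finsupp.linearCombination_apply,
        Finsupp.sum_fintype _ _ fun i => zero_smul ℤ (Additive.ofMul (c i))]
      exact this
  refine ⟨fun γ => (f (Finsupp.single γ 1)).toMul, fun i => ?_⟩
  have hi : f (t i) = Additive.ofMul (c i) := by
    simpa [tA_single] using LinearMap.congr_fun hf (Finsupp.single i 1)
  have ht : t i = ∑ γ, (t i) γ • Finsupp.single γ (1 : ℤ) := by
    ext γ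
    simp
  rw [ht, map_sum] at hi
  simp only [map_zsmul] at hi
  exact hi

theorem gaugeEquiv_of_evalMon_eq {k Φ Γ : Type*} [Field k] [IsAlgClosed k] [Fintype Φ] [Fintype Γ]
    (t : Φ → (Γ →₀ ℤ)) (F F' : Φ → k) (h0 : ∀ φ, F φ = 0 ↔ F' φ = 0)
    (h : ∀ m : Φ →₀ ℤ, tA t m = 0 → (∀ φ ∈ m.support, F φ ≠ 0) → evalMon F m = evalMon F' m) :
    gaugeEquiv t F F' := by
  classical
  let u (i : {φ // F φ ≠ 0}) : kˣ := Units.mk0 (F i) i.2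
  let u' (i : {φ // F φ ≠ 0}) : kˣ := Units.mk0 (F' i) (mt (h0 i).2 i.2)
  have hsum (m : {φ // F φ ≠ 0} →₀ ℤ) (hm : tA (fun i => t i.1) m = 0) :
      ∏ i, (u' i / u i) ^ m i = 1 := by
    have hval (i : {φ // F φ ≠ 0}) : m.mapDomain Subtype.val i.1 = m i :=
      Finsupp.mapDomain_apply Subtype.val_injective m i
    have hout (φ : Φ) (hφ : ¬ F φ ≠ 0) : m.mapDomain Subtype.val φ = 0 :=
      Finsupp.mapDomain_of_notMem_range m φ (by simpa using hφ)
    have hev (G : Φ → k) :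
        evalMon G (m.mapDomain Subtype.val) = ∏ i : {φ // F φ ≠ 0}, G i ^ m i := by
      rw [evalMon, ← Fintype.prod_subtype_mul_prod_subtype (fun φ => F φ ≠ 0),
        Fintype.prod_eq_one (fun i : {φ // ¬ F φ ≠ 0} => _) fun i => by simp [hout _ i.2], mul_one]
      simp only [hval]
    have htA : tA t (m.mapDomain Subtype.val) = 0 := by
      rw [← hm, tA_apply, tA_apply, ← Fintype.sum_subtype_add_sum_subtype (fun φ => F φ ≠ 0),
        Fintype.sum_eq_zero (fun i : {φ // ¬ F φ ≠ 0} => _) fun i => by simp [hout _ i.2], add_zero]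
      simp only [hval]
    have key := h _ htA fun φ hφ => by
      by_contra hF
      exact Finsupp.mem_support_iff.1 hφ (hout φ (not_not.2 hF))
    rw [hev, hev] at key
    simp only [div_zpow, Finset.prod_div_distrib, div_eq_one]
    apply Units.ext
    simpa [u, u', Units.coe_prod] using key.symm
  obtain ⟨g, hg⟩ := exists_torus_point _ _ hsum
  refine ⟨g, funext fun φ => ?_⟩
  by_cases hφ : F φ = 0
  · rw [(h0 φ).1 hφ, (gaugeAct_eq_zero_iff t g F φ).2 hφ]
  · rw [gaugeAct, hg ⟨φ, hφ⟩]
    simp [u, u', hφ]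

/-- Monoidal (permutation-and-gauge) equivalence is detected by zero sets together with
evaluations of invariant monomials, twisted by a permutation from `P`. -/
theorem monoidalEquiv_iff_zeroSet_and_evalMon {k : Type*} [Field k] [IsAlgClosed k] [CharZero k]
    {Φ Γ : Type*} [Fintype Φ] [Fintype Γ] (t : Φ → (Γ →₀ ℤ))
    (P : Set (Equiv.Perm Φ × Equiv.Perm Γ))
    (hP : ∀ ρ ∈ P, ∀ φ : Φ, t (ρ.1 φ) = Finsupp.equivMapDomain ρ.2 (t φ))
    (F F' : Φ → k) :
    (∃ ρ ∈ P, ∃ g : Γ → kˣ, F' = gaugeAct t g (permAct ρ.1 F)) ↔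
      ∃ ρ ∈ P, ρ.1 '' {φ : Φ | F φ = 0} = {φ : Φ | F' φ = 0} ∧
        ∀ m : Φ →₀ ℤ, tA t m = 0 → (∀ φ ∈ m.support, F φ ≠ 0) →
          evalMon F m = evalMon F' (Finsupp.equivMapDomain ρ.1 m) := by
  refine exists_congr fun ρ => and_congr_right fun hρ => ?_
  have hρt := tA_equivMapDomain t ρ.1 ρ.2 (hP ρ hρ)
  constructor
  · rintro ⟨g, rfl⟩
    refine ⟨?_, fun m hm _ => ?_⟩
    · ext φ
      simp [Equiv.image_eq_preimage_symm, gaugeAct_eq_zero_iff, permAct]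
    · rw [evalMon_gaugeAct, hρt, hm, evalMon_permAct_equivMapDomain]
      simp [Finsupp.equivMapDomain_zero]
  · rintro ⟨h0, h⟩
    refine gaugeEquiv_of_evalMon_eq t (permAct ρ.1 F) F' (fun φ => ?_) fun m hm hF => ?_
    · simpa [Equiv.image_eq_preimage_symm, permAct] using Set.ext_iff.1 h0 φ
    · obtain ⟨m, rfl⟩ : ∃ n, m = Finsupp.equivMapDomain ρ.1 n :=
        ⟨Finsupp.equivMapDomain ρ.1.symm m, by ext; simp [Finsupp.equivMapDomain_apply]⟩
      rw [evalMon_permAct_equivMapDomain]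
      refine h m ?_ fun φ hφ => ?_
      · rw [hρt] at hm
        ext γ
        simpa [Finsupp.equivMapDomain_apply] using DFunLike.congr_fun hm (ρ.2 γ)
      · simpa [permAct] using hF (ρ.1 φ) (by simpa [Finsupp.equivMapDomain_apply] using hφ)
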